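/- Let p be a prime and let k be an algebraic closure of the field 𝔽_p with p elements. Equip the endomorphism ring End(kˣ) of the abelian group kˣ with the topology of pointwise convergence (kˣ discrete). Then the unique continuous ring homomorphism Φ : ∏_{q≠p} ℤ_q → End(kˣ) (product of the rings of q-adic integers over all primes q ≠ p) satisfying Φ(n) = (z ↦ zⁿ) for every integer n is an isomorphism of topological rings; in particular, restriction to units gives an isomorphism of topological groups from ∏_{q≠p} ℤ_qˣ onto the automorphism group Aut(kˣ). -/

import Mathlib

noncomputable section

instance (p : Nat.Primes) : Fact (Nat.Prime (p : ℕ)) := ⟨p.2⟩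

/-- `Ẑ = ∏_p ℤ_p`, the product of the rings of `p`-adic integers over all primes,
with the product topology. -/
abbrev ZHat : Type := ∀ p : Nat.Primes, ℤ_[(p : ℕ)]

/-- `∏_{q ≠ p} ℤ_q`, the product of the rings of `q`-adic integers over all primes `q ≠ p`,
with the product topology. -/
abbrev ZHatAway (p : Nat.Primes) : Type :=
  ∀ q : {q : Nat.Primes // q ≠ p}, ℤ_[((q : Nat.Primes) : ℕ)]

/-- An algebraic closure `k` of the field `𝔽_p` with `p` elements. -/
abbrev Kbar (p : Nat.Primes) : Type := AlgebraicClosure (ZMod (p : ℕ))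

/-- The endomorphism ring of the abelian group `kˣ`. -/
abbrev EndKbar (p : Nat.Primes) : Type := AddMonoid.End (Additive (Kbar p)ˣ)

/-- The topology of pointwise convergence on `End(kˣ)` (with `kˣ` discrete). -/
instance (p : Nat.Primes) : TopologicalSpace (EndKbar p) :=
  TopologicalSpace.induced (fun f : EndKbar p => (⇑f : Additive (Kbar p)ˣ → Additive (Kbar p)ˣ))
    (@Pi.topologicalSpace (Additive (Kbar p)ˣ) (fun _ => Additive (Kbar p)ˣ) (fun _ => ⊥))

theorem Kbar.pow_p_injective (p : Nat.Primes) {z w : (Kbar p)ˣ} (h : z ^ (p : ℕ) = w ^ (p : ℕ)) :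
    z = w := by
  have : (z : Kbar p) ^ (p : ℕ) = (w : Kbar p) ^ (p : ℕ) := by exact_mod_cast congrArg Units.val h
  exact Units.ext (frobenius_inj (Kbar p) (p : ℕ) this)

theorem Kbar.isOfFinOrder (p : Nat.Primes) (z : (Kbar p)ˣ) : IsOfFinOrder z := by
  have hz : IsIntegral (ZMod (p : ℕ)) (z : Kbar p) := Algebra.IsIntegral.isIntegral _
  let L := IntermediateField.adjoin (ZMod (p : ℕ)) {(z : Kbar p)}
  have : FiniteDimensional (ZMod (p : ℕ)) L := IntermediateField.adjoin.finiteDimensional hz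
  have : Finite L := Module.finite_of_finite (ZMod (p : ℕ))
  let w : L := ⟨z, IntermediateField.mem_adjoin_simple_self _ _⟩
  have hw : w ≠ 0 := fun h => z.ne_zero (congrArg Subtype.val h)
  obtain ⟨n, hn, h⟩ := isOfFinOrder_iff_pow_eq_one.1 (isOfFinOrder_of_finite (Units.mk0 w hw))
  refine isOfFinOrder_iff_pow_eq_one.2 ⟨n, hn, Units.ext ?_⟩
  simpa [w] using congrArg (fun u : Lˣ => ((u : L) : Kbar p)) h

theorem Kbar.not_dvd_orderOf (p : Nat.Primes) (z : (Kbar p)ˣ) : ¬ (p : ℕ) ∣ orderOf z := by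
  rintro ⟨j, hj⟩
  have h1 : z ^ j = 1 := Kbar.pow_p_injective p (by
    rw [one_pow, ← pow_mul, mul_comm, ← hj, pow_orderOf_eq_one])
  have hpos := (Kbar.isOfFinOrder p z).orderOf_pos
  have h2 : orderOf z ≤ j := Nat.le_of_dvd (by by_contra! h; simp_all) (orderOf_dvd_of_pow_eq_one h1)
  have := p.2.two_le
  nlinarith

theorem Kbar.exists_isPrimitiveRoot (p : Nat.Primes) {n : ℕ} (hn : ¬ (p : ℕ) ∣ n) :
    ∃ ζ : (Kbar p)ˣ, IsPrimitiveRoot ζ n := by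
  have hn0 : n ≠ 0 := fun h => hn (h ▸ dvd_zero _)
  have : NeZero n := ⟨hn0⟩
  have : NeZero (n : Kbar p) := ⟨by rwa [Ne, CharP.cast_eq_zero_iff (Kbar p) (p : ℕ)]⟩
  obtain ⟨ζ, hζ⟩ := HasEnoughRootsOfUnity.exists_primitiveRoot (Kbar p) n
  exact ⟨(hζ.isUnit hn0).unit, hζ.isUnit_unit hn0⟩

theorem ZHatAway.isUnit_natCast {q r : Nat.Primes} (h : q ≠ r) :
    IsUnit ((r : ℕ) : ℤ_[(q : ℕ)]) := by
  rw [PadicInt.isUnit_iff, PadicInt.norm_natCast_eq_one_iff]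
  exact (Nat.coprime_primes q.2 r.2).2 fun h' => h (Subtype.ext h')

theorem ZHatAway.exists_eq_int_add_prime_mul (p r : Nat.Primes) (x : ZHatAway p) :
    ∃ (a : ℤ) (y : ZHatAway p), x = a + ((r : ℕ) : ZHatAway p) * y := by
  obtain ⟨a, ha⟩ : ∃ a : ℤ, ∀ q : {q : Nat.Primes // q ≠ p},
      ((r : ℕ) : ℤ_[((q : Nat.Primes) : ℕ)]) ∣ x q - a := by
    by_cases hr : r = p
    · exact ⟨0, fun q => (ZHatAway.isUnit_natCast (hr ▸ q.2)).dvd⟩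
    · refine ⟨(x ⟨r, hr⟩).zmodRepr, fun q => ?_⟩
      by_cases hq : (q : Nat.Primes) = r
      · obtain ⟨q, hqp⟩ := q
        subst hq
        have := PadicInt.sub_zmodRepr_mem (x ⟨q, hr⟩)
        rwa [PadicInt.maximalIdeal_eq_span_p, Ideal.mem_span_singleton] at this
      · exact (ZHatAway.isUnit_natCast hq).dvd
  choose y hy using ha
  refine ⟨a, y, funext fun q => ?_⟩
  have := hy q
  simp only [Pi.add_apply, Pi.mul_apply, Pi.intCast_apply, Pi.natCast_apply, ← this]
  ring

theorem ZHatAway.exists_eq_int_add_mul (p : Nat.Primes) {n : ℕ} (hn : n ≠ 0) (x : ZHatAway p) :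
    ∃ (a : ℤ) (y : ZHatAway p), x = a + (n : ZHatAway p) * y := by
  induction n using Nat.recOnMul generalizing x with
  | zero => exact absurd rfl hn
  | one => exact ⟨0, x, by simp⟩
  | prime r hr => exact ZHatAway.exists_eq_int_add_prime_mul p ⟨r, hr⟩ x
  | mul m n hm' hn' =>
    obtain ⟨a, y, rfl⟩ := hm' (left_ne_zero_of_mul hn) x
    obtain ⟨b, w, rfl⟩ := hn' (right_ne_zero_of_mul hn) y
    exact ⟨a + m * b, w, by push_cast; ring⟩

theorem ZHatAway.dvd_of_intCast_eq_mul (p : Nat.Primes) {n : ℕ} (hn : ¬ (p : ℕ) ∣ n) {a : ℤ}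
    {y : ZHatAway p} (h : (a : ZHatAway p) = (n : ZHatAway p) * y) : (n : ℤ) ∣ a := by
  rw [Int.natCast_dvd]
  refine (Nat.dvd_iff_prime_pow_dvd_dvd _ _).2 fun r k hr hrk => ?_
  rcases k.eq_zero_or_pos with rfl | hk
  · simp
  have hrp : (⟨r, hr⟩ : Nat.Primes) ≠ p := by
    rintro rfl
    exact hn ((dvd_pow_self r hk.ne').trans hrk)
  have : Fact r.Prime := ⟨hr⟩
  have h1 := congrFun h ⟨⟨r, hr⟩, hrp⟩
  have h2 : ((r ^ k : ℕ) : ℤ_[r]) ∣ (a : ℤ_[r]) := (Nat.cast_dvd_cast hrk).trans ⟨_, h1⟩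
  rw [← Int.natCast_dvd]
  rw [Nat.cast_pow, PadicInt.pow_p_dvd_int_iff] at h2
  exact_mod_cast h2

theorem ZHatAway.eq_zero_of_forall_dvd (p : Nat.Primes) {x : ZHatAway p}
    (h : ∀ n : ℕ, ¬ (p : ℕ) ∣ n → (n : ZHatAway p) ∣ x) : x = 0 := by
  funext q
  by_contra hx
  obtain ⟨k, hk⟩ := exists_pow_lt_of_lt_one (norm_pos_iff.2 hx)
    ((PadicInt.norm_int_lt_one_iff_dvd ((q : Nat.Primes) : ℕ)).2 dvd_rfl)
  obtain ⟨y, rfl⟩ := h (((q : Nat.Primes) : ℕ) ^ k) fun hd =>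
    q.2 (Subtype.ext ((Nat.prime_dvd_prime_iff_eq p.2 q.1.2).1 (p.2.dvd_of_dvd_pow hd)).symm)
  rw [Pi.mul_apply, Pi.natCast_apply, Nat.cast_pow, norm_mul, norm_pow, Int.cast_natCast] at hk
  exact absurd hk (not_lt.2 (mul_le_of_le_one_right (by positivity) (PadicInt.norm_le_one _)))

theorem ZHatAway.exists_power (p : Nat.Primes) (x : ZHatAway p) (z : (Kbar p)ˣ) :
    ∃ w : (Kbar p)ˣ, ∀ (n : ℕ) (a : ℤ) (y : ZHatAway p), n ≠ 0 → z ^ n = 1 →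
      x = a + (n : ZHatAway p) * y → w = z ^ a := by
  obtain ⟨b, u, hb⟩ := ZHatAway.exists_eq_int_add_mul p (Kbar.isOfFinOrder p z).orderOf_pos.ne' x
  refine ⟨z ^ b, fun n a y _ hz hx => ?_⟩
  obtain ⟨d, rfl⟩ := orderOf_dvd_of_pow_eq_one hz
  have h : ((b - a : ℤ) : ZHatAway p) = (orderOf z : ZHatAway p) * (d * y - u) := by
    rw [hb] at hx
    push_cast at hx ⊢
    linear_combination hx
  have := ZHatAway.dvd_of_intCast_eq_mul p (Kbar.not_dvd_orderOf p z) h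
  rw [← sub_add_cancel b a, zpow_add, orderOf_dvd_iff_zpow_eq_one.1 this, one_mul]

/-- The power `z ^ x` of `z ∈ kˣ` with profinite exponent `x ∈ ∏_{q ≠ p} ℤ_q`. -/
def ZHatAway.power (p : Nat.Primes) (x : ZHatAway p) (z : (Kbar p)ˣ) : (Kbar p)ˣ :=
  (ZHatAway.exists_power p x z).choose

theorem ZHatAway.power_eq (p : Nat.Primes) {x : ZHatAway p} {z : (Kbar p)ˣ} {n : ℕ} {a : ℤ}
    {y : ZHatAway p} (hn : n ≠ 0) (hz : z ^ n = 1) (hx : x = a + (n : ZHatAway p) * y) :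
    ZHatAway.power p x z = z ^ a :=
  (ZHatAway.exists_power p x z).choose_spec n a y hn hz hx

theorem ZHatAway.power_intCast (p : Nat.Primes) (a : ℤ) (z : (Kbar p)ˣ) :
    ZHatAway.power p a z = z ^ a :=
  ZHatAway.power_eq p (Kbar.isOfFinOrder p z).orderOf_pos.ne' (pow_orderOf_eq_one z)
    (y := 0) (by simp)

theorem ZHatAway.power_mul (p : Nat.Primes) (x : ZHatAway p) (z w : (Kbar p)ˣ) :
    ZHatAway.power p x (z * w) = ZHatAway.power p x z * ZHatAway.power p x w := by
  have hn : orderOf z * orderOf w ≠ 0 := mul_ne_zero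
    (Kbar.isOfFinOrder p z).orderOf_pos.ne' (Kbar.isOfFinOrder p w).orderOf_pos.ne'
  obtain ⟨a, y, h⟩ := ZHatAway.exists_eq_int_add_mul p hn x
  have hz : z ^ (orderOf z * orderOf w) = 1 := by rw [pow_mul, pow_orderOf_eq_one, one_pow]
  have hw : w ^ (orderOf z * orderOf w) = 1 := by
    rw [mul_comm, pow_mul, pow_orderOf_eq_one, one_pow]
  rw [ZHatAway.power_eq p hn hz h, ZHatAway.power_eq p hn hw h,
    ZHatAway.power_eq p hn (by rw [mul_pow, hz, hw, one_mul]) h, mul_zpow]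

theorem ZHatAway.add_power (p : Nat.Primes) (x y : ZHatAway p) (z : (Kbar p)ˣ) :
    ZHatAway.power p (x + y) z = ZHatAway.power p x z * ZHatAway.power p y z := by
  have hn := (Kbar.isOfFinOrder p z).orderOf_pos.ne'
  have hz := pow_orderOf_eq_one z
  obtain ⟨a, u, hx⟩ := ZHatAway.exists_eq_int_add_mul p hn x
  obtain ⟨b, v, hy⟩ := ZHatAway.exists_eq_int_add_mul p hn y
  rw [ZHatAway.power_eq p hn hz hx, ZHatAway.power_eq p hn hz hy, ← zpow_add]
  exact ZHatAway.power_eq p hn hz (y := u + v) (by rw [hx, hy]; push_cast; ring)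

theorem ZHatAway.mul_power (p : Nat.Primes) (x y : ZHatAway p) (z : (Kbar p)ˣ) :
    ZHatAway.power p (x * y) z = ZHatAway.power p x (ZHatAway.power p y z) := by
  have hn := (Kbar.isOfFinOrder p z).orderOf_pos.ne'
  have hz := pow_orderOf_eq_one z
  obtain ⟨a, u, hx⟩ := ZHatAway.exists_eq_int_add_mul p hn x
  obtain ⟨b, v, hy⟩ := ZHatAway.exists_eq_int_add_mul p hn y
  rw [ZHatAway.power_eq p hn hz hy, ZHatAway.power_eq p hn (by
    rw [← zpow_natCast, zpow_comm, zpow_natCast, hz, one_zpow]) hx, ← zpow_mul]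
  exact ZHatAway.power_eq p hn hz (y := a * v + b * u + orderOf z * u * v) (by
    rw [hx, hy]; push_cast; ring)

/-- The ring homomorphism `∏_{q ≠ p} ℤ_q → End(kˣ)`, `x ↦ (z ↦ z ^ x)`. -/
def ZHatAway.toEnd (p : Nat.Primes) : ZHatAway p →+* EndKbar p where
  toFun x := (AddMonoidHom.mk' (fun z : Additive (Kbar p)ˣ =>
    Additive.ofMul (ZHatAway.power p x z.toMul)) fun z w =>
      congrArg Additive.ofMul (ZHatAway.power_mul p x z.toMul w.toMul))
  map_one' := AddMonoidHom.ext fun z => congrArg Additive.ofMul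
    (by simpa using ZHatAway.power_intCast p 1 z.toMul :
      ZHatAway.power p 1 z.toMul = z.toMul)
  map_mul' x y := AddMonoidHom.ext fun z => congrArg Additive.ofMul
    (ZHatAway.mul_power p x y z.toMul)
  map_zero' := AddMonoidHom.ext fun z => congrArg Additive.ofMul
    (by simpa using ZHatAway.power_intCast p 0 z.toMul :
      ZHatAway.power p 0 z.toMul = 1)
  map_add' x y := AddMonoidHom.ext fun z => congrArg Additive.ofMul
    (ZHatAway.add_power p x y z.toMul)

theorem ZHatAway.isClosed_power_preimage (p : Nat.Primes) (z : (Kbar p)ˣ) (S : Set (Kbar p)ˣ) :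
    IsClosed {x : ZHatAway p | ZHatAway.power p x z ∈ S} := by
  have hn := (Kbar.isOfFinOrder p z).orderOf_pos.ne'
  have hz := pow_orderOf_eq_one z
  have key : {x : ZHatAway p | ZHatAway.power p x z ∈ S} =
      ⋃ a ∈ {a : ℕ | a < orderOf z ∧ z ^ a ∈ S},
        Set.range fun y : ZHatAway p => (a : ZHatAway p) + (orderOf z : ZHatAway p) * y := by
    ext x
    simp only [Set.mem_ofPred_eq, Set.mem_iUnion, Set.mem_range, exists_prop]
    constructor
    · intro hx
      obtain ⟨b, y, hb⟩ := ZHatAway.exists_eq_int_add_mul p hn x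
      obtain ⟨a, ha⟩ := Int.eq_ofNat_of_zero_le (Int.emod_nonneg b (Int.natCast_ne_zero.2 hn))
      have hba : b = a + orderOf z * (b / orderOf z) := by rw [← ha, Int.emod_add_mul_ediv]
      have hxa : x = ((a : ℤ) : ZHatAway p) +
          (orderOf z : ZHatAway p) * (((b / orderOf z : ℤ) : ZHatAway p) + y) := by
        rw [hb]
        nth_rewrite 1 [hba]
        push_cast
        ring
      refine ⟨a, ⟨?_, ?_⟩, ((b / orderOf z : ℤ) : ZHatAway p) + y, ?_⟩
      · have := Int.emod_lt_of_pos b (Int.natCast_pos.2 (Nat.pos_of_ne_zero hn))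
        omega
      · rwa [ZHatAway.power_eq p hn hz hxa, zpow_natCast] at hx
      · rw [hxa, Int.cast_natCast]
    · rintro ⟨a, ⟨-, ha⟩, y, rfl⟩
      rwa [ZHatAway.power_eq p hn hz (a := a) (by rw [Int.cast_natCast]), zpow_natCast]
  rw [key]
  refine Set.Finite.isClosed_biUnion ((Set.finite_lt_nat (orderOf z)).subset fun a ha => ha.1)
    fun a _ => (isCompact_range ?_).isClosed
  fun_prop

theorem ZHatAway.continuous_toEnd (p : Nat.Primes) : Continuous (ZHatAway.toEnd p) := by
  refine continuous_induced_rng.2 ?_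
  refine @continuous_pi _ _ _ _ (fun _ => ⊥) _ fun z => ?_
  refine (@continuous_iff_isClosed _ _ _ ⊥ _).2 fun S _ => ?_
  exact ZHatAway.isClosed_power_preimage p z.toMul (Additive.ofMul ⁻¹' S)

theorem ZHatAway.toEnd_injective (p : Nat.Primes) : Function.Injective (ZHatAway.toEnd p) := by
  refine (injective_iff_map_eq_zero _).2 fun x hx => ZHatAway.eq_zero_of_forall_dvd p fun n hn => ?_
  have hn0 : n ≠ 0 := fun h => hn (h ▸ dvd_zero _)
  obtain ⟨ζ, hζ⟩ := Kbar.exists_isPrimitiveRoot p hn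
  obtain ⟨a, y, rfl⟩ := ZHatAway.exists_eq_int_add_mul p hn0 x
  have h1 : ZHatAway.power p (a + n * y) ζ = 1 :=
    congrArg Additive.toMul (DFunLike.congr_fun hx (Additive.ofMul ζ))
  rw [ZHatAway.power_eq p hn0 hζ.pow_eq_one rfl, hζ.zpow_eq_one_iff_dvd] at h1
  obtain ⟨c, rfl⟩ := h1
  exact ⟨c + y, by push_cast; ring⟩

theorem Kbar.exists_int_eq_zpow (p : Nat.Primes) (f : (Kbar p)ˣ →* (Kbar p)ˣ)
    (s : Finset (Kbar p)ˣ) : ∃ a : ℤ, ∀ z ∈ s, f z = z ^ a := by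
  have hpn : ¬ (p : ℕ) ∣ ∏ z ∈ s, orderOf z := fun h => by
    obtain ⟨z, -, hz⟩ := (p.2.prime.dvd_finsetProd_iff _).1 h
    exact Kbar.not_dvd_orderOf p z hz
  have hs : ∀ z ∈ s, z ^ (∏ z ∈ s, orderOf z) = 1 := fun z hz =>
    orderOf_dvd_iff_pow_eq_one.1 (Finset.dvd_prod_of_mem orderOf hz)
  generalize ∏ z ∈ s, orderOf z = n at hpn hs
  have : NeZero n := ⟨fun h => hpn (h ▸ dvd_zero _)⟩
  obtain ⟨ζ, hζ⟩ := Kbar.exists_isPrimitiveRoot p hpn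
  have hroot (w : (Kbar p)ˣ) (hw : w ^ n = 1) : ∃ i : ℕ, ζ ^ i = w := by
    obtain ⟨i, -, hi⟩ := (IsPrimitiveRoot.coe_units_iff.2 hζ).eq_pow_of_pow_eq_one
      (ξ := (w : Kbar p)) (by rw [← Units.val_pow_eq_pow_val, hw, Units.val_one])
    exact ⟨i, Units.ext (by rw [Units.val_pow_eq_pow_val, hi])⟩
  obtain ⟨a, ha⟩ := hroot (f ζ) (by rw [← map_pow, hζ.pow_eq_one, map_one])
  refine ⟨a, fun z hz => ?_⟩
  obtain ⟨i, rfl⟩ := hroot z (hs z hz)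
  rw [map_pow, ← ha, zpow_natCast, ← pow_mul, ← pow_mul, mul_comm]

theorem ZHatAway.toEnd_surjective (p : Nat.Primes) : Function.Surjective (ZHatAway.toEnd p) := by
  intro f
  have hK (z : Additive (Kbar p)ˣ) : IsClosed {x : ZHatAway p | ZHatAway.toEnd p x z = f z} :=
    ZHatAway.isClosed_power_preimage p z.toMul {(f z).toMul}
  obtain ⟨x, -, hx⟩ := isCompact_univ.inter_iInter_nonempty _ hK fun s => by
    obtain ⟨a, ha⟩ := Kbar.exists_int_eq_zpow p (MonoidHom.mk' (fun z => (f (.ofMul z)).toMul)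
      fun z w => congrArg Additive.toMul (map_add f (.ofMul z) (.ofMul w)))
      (s.map Additive.toMul.toEmbedding)
    exact ⟨a, trivial, Set.mem_iInter₂.2 fun z hz => congrArg Additive.ofMul
      ((ZHatAway.power_intCast p a z.toMul).trans
        (ha z.toMul (Finset.mem_map_of_mem _ hz)).symm)⟩
  exact ⟨x, AddMonoidHom.ext fun z => Set.mem_iInter.1 hx z⟩

instance (p : Nat.Primes) : T2Space (EndKbar p) :=
  letI : TopologicalSpace (Additive (Kbar p)ˣ) := ⊥
  haveI : DiscreteTopology (Additive (Kbar p)ˣ) := ⟨rfl⟩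
  T2Space.of_injective_continuous
    (f := fun f : EndKbar p => (⇑f : Additive (Kbar p)ˣ → Additive (Kbar p)ˣ))
    DFunLike.coe_injective continuous_induced_dom

/-- The ring isomorphism `∏_{q ≠ p} ℤ_q ≃ End(kˣ)`, `x ↦ (z ↦ z ^ x)`. -/
def ZHatAway.equivEnd (p : Nat.Primes) : ZHatAway p ≃+* EndKbar p :=
  RingEquiv.ofBijective (ZHatAway.toEnd p)
    ⟨ZHatAway.toEnd_injective p, ZHatAway.toEnd_surjective p⟩

theorem ZHatAway.continuous_equivEnd_symm (p : Nat.Primes) :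
    Continuous (ZHatAway.equivEnd p).symm :=
  Continuous.continuous_symm_of_equiv_compact_to_t2 (f := (ZHatAway.equivEnd p).toEquiv)
    (ZHatAway.continuous_toEnd p)

theorem ZHatAway.ringHom_apply_eq (p : Nat.Primes) (Ψ : ZHatAway p →+* EndKbar p) (x : ZHatAway p) :
    Ψ x = ZHatAway.toEnd p x := by
  refine AddMonoidHom.ext fun z => ?_
  have hn := (Kbar.isOfFinOrder p z.toMul).orderOf_pos.ne'
  have hz : orderOf z.toMul • z = 0 := congrArg Additive.ofMul (pow_orderOf_eq_one z.toMul)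
  obtain ⟨a, y, rfl⟩ := ZHatAway.exists_eq_int_add_mul p hn x
  have key (Θ : ZHatAway p →+* EndKbar p) :
      Θ (a + (orderOf z.toMul : ZHatAway p) * y) z = a • z := by
    rw [map_add, map_mul, map_intCast, map_natCast]
    change (a : EndKbar p) z + (orderOf z.toMul : EndKbar p) (Θ y z) = a • z
    rw [AddMonoid.End.natCast_apply, AddMonoid.End.intCast_apply, ← map_nsmul, hz, map_zero,
      add_zero]
  exact (key Ψ).trans (key _).symm

/-- the unique continuous ring homomorphism `Φ : ∏_{q ≠ p} ℤ_q → End(kˣ)` with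
`Φ n = (z ↦ zⁿ)` for all integers `n` is an isomorphism of topological rings; restricting to
units gives an isomorphism of topological groups `∏_{q ≠ p} ℤ_qˣ ≃ Aut(kˣ)`. -/
theorem statement11 (p : Nat.Primes) :
    ∃ Φ : ZHatAway p ≃+* EndKbar p,
      Continuous (⇑Φ) ∧ Continuous (⇑Φ.symm) ∧
      (∀ (n : ℤ) (z : (Kbar p)ˣ),
        Additive.toMul (Φ ((n : ZHatAway p)) (Additive.ofMul z)) = z ^ n) ∧
      (∀ Ψ : ZHatAway p →+* EndKbar p, Continuous (⇑Ψ) →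
        (∀ (n : ℤ) (z : (Kbar p)ˣ),
          Additive.toMul (Ψ ((n : ZHatAway p)) (Additive.ofMul z)) = z ^ n) →
        ∀ x : ZHatAway p, Ψ x = Φ x) ∧
      ∃ Ψu : (∀ q : {q : Nat.Primes // q ≠ p}, ℤ_[((q : Nat.Primes) : ℕ)]ˣ) ≃* (EndKbar p)ˣ,
        Continuous (⇑Ψu) ∧ Continuous (⇑Ψu.symm) ∧
        ∀ u, ((Ψu u : (EndKbar p)ˣ) : EndKbar p) =
          Φ (fun q => ((u q : ℤ_[((q : Nat.Primes) : ℕ)]) : ℤ_[((q : Nat.Primes) : ℕ)])) := by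
  refine ⟨ZHatAway.equivEnd p, ZHatAway.continuous_toEnd p, ZHatAway.continuous_equivEnd_symm p,
    ZHatAway.power_intCast p, fun Ψ _ _ => ZHatAway.ringHom_apply_eq p Ψ,
    MulEquiv.piUnits.symm.trans (Units.mapEquiv (ZHatAway.equivEnd p).toMulEquiv), ?_, ?_,
    fun _ => rfl⟩
  · exact (Continuous.units_map (ZHatAway.equivEnd p).toMulEquiv.toMonoidHom
      (ZHatAway.continuous_toEnd p)).comp ContinuousMulEquiv.piUnits.symm.continuous
  · exact ContinuousMulEquiv.piUnits.continuous.comp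
      (Continuous.units_map (ZHatAway.equivEnd p).symm.toMulEquiv.toMonoidHom
        (ZHatAway.continuous_equivEnd_symm p))
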